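/- arXiv:0809.0948 — 2 statements merged into one kernel-verified Lean document; each statement's English description precedes it below -/
import Mathlib

section
/- For every element x of a Garside group G of finite type, iterated application of cyclic sliding eventually reaches a period: there are integers 0 ≤ i < j such that 𝔰^i(x) = 𝔰^j(x). In particular, 𝔰^k(x) ∈ SC(x) and 𝔰^{j−i}(𝔰^k(x)) = 𝔰^k(x) for all k ≥ i. -/
/-- A Garside structure of finite type on a group `G`: a submonoid `P` of positive
elements with `P ∩ P⁻¹ = {1}`, such that the prefix order `a ⪯ b ↔ a⁻¹ * b ∈ P` is a
lattice order (with meet `wedge` and join `vee`), together with a Garside element `Δ ∈ P`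
whose set of prefixes (the simple elements) is finite and generates `G`, satisfying
`Δ⁻¹ P Δ = P`, and such that every nontrivial positive element has a finite norm. -/
structure GarsideStructure (G : Type*) [Group G] where
  P : Set G
  one_mem : (1 : G) ∈ P
  mul_mem : ∀ {a b : G}, a ∈ P → b ∈ P → a * b ∈ P
  eq_one_of_mem_of_inv_mem : ∀ a : G, a ∈ P → a⁻¹ ∈ P → a = 1
  wedge : G → G → G
  vee : G → G → G
  wedge_le_left : ∀ a b : G, (wedge a b)⁻¹ * a ∈ P
  wedge_le_right : ∀ a b : G, (wedge a b)⁻¹ * b ∈ P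
  le_wedge : ∀ a b c : G, c⁻¹ * a ∈ P → c⁻¹ * b ∈ P → c⁻¹ * wedge a b ∈ P
  le_vee_left : ∀ a b : G, a⁻¹ * vee a b ∈ P
  le_vee_right : ∀ a b : G, b⁻¹ * vee a b ∈ P
  vee_le : ∀ a b c : G, a⁻¹ * c ∈ P → b⁻¹ * c ∈ P → (vee a b)⁻¹ * c ∈ P
  Δ : G
  Δ_mem : Δ ∈ P
  simples_finite : {s : G | s ∈ P ∧ s⁻¹ * Δ ∈ P}.Finite
  simples_generate : Subgroup.closure {s : G | s ∈ P ∧ s⁻¹ * Δ ∈ P} = (⊤ : Subgroup G)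
  conj_Delta_mem : ∀ a : G, a ∈ P → Δ⁻¹ * a * Δ ∈ P
  mem_of_conj_Delta_mem : ∀ a : G, Δ⁻¹ * a * Δ ∈ P → a ∈ P
  norm_bounded : ∀ x : G, x ∈ P → x ≠ 1 →
    ∃ n : ℕ, ∀ L : List G, (∀ a ∈ L, a ∈ P ∧ a ≠ 1) → L.prod = x → L.length ≤ n

namespace GarsideStructure

variable {G : Type*} [Group G] (gs : GarsideStructure G)

/-- The prefix order: `a ⪯ b`. -/
def pre (a b : G) : Prop := a⁻¹ * b ∈ gs.P

/-- The suffix order: `a ≽ b` (i.e. `b` is a suffix of `a`). -/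
def rdvd (a b : G) : Prop := a * b⁻¹ ∈ gs.P

/-- Greatest common divisor with respect to the suffix order `≽` : `a ∧↰ b`. -/
def rwedge (a b : G) : G := (gs.vee a⁻¹ b⁻¹)⁻¹

/-- Least common multiple with respect to the suffix order `≽` : `a ∨↰ b`. -/
def rvee (a b : G) : G := (gs.wedge a⁻¹ b⁻¹)⁻¹

/-- Simple elements: positive prefixes of `Δ`. -/
def simple (s : G) : Prop := s ∈ gs.P ∧ s⁻¹ * gs.Δ ∈ gs.P

/-- Atoms: nontrivial positive elements which cannot be decomposed in `P`. -/
def atom (a : G) : Prop := a ∈ gs.P ∧ a ≠ 1 ∧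
  ∀ b c : G, b ∈ gs.P → c ∈ gs.P → a = b * c → b = 1 ∨ c = 1

/-- `inf x` : the maximal integer `p` with `Δ^p ⪯ x`. -/
noncomputable def ginf (x : G) : ℤ := sSup {p : ℤ | gs.pre (gs.Δ ^ p) x}

/-- `sup x` : the minimal integer `p` with `x ⪯ Δ^p`. -/
noncomputable def gsup (x : G) : ℤ := sInf {p : ℤ | gs.pre x (gs.Δ ^ p)}

/-- Canonical length `ℓ(x) = sup(x) - inf(x)`. -/
noncomputable def glen (x : G) : ℤ := gs.gsup x - gs.ginf x

/-- `‖x‖` : the maximal number of factors in a decomposition of `x` as a product of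
nontrivial positive elements. -/
noncomputable def gnorm (x : G) : ℕ :=
  sSup {k : ℕ | ∃ L : List G, (∀ a ∈ L, a ∈ gs.P ∧ a ≠ 1) ∧ L.prod = x ∧ L.length = k}

/-- The summit infimum `inf_s(x)` : the maximum of `inf` over the conjugacy class of `x`. -/
noncomputable def ginfs (x : G) : ℤ :=
  sSup {p : ℤ | ∃ y : G, (∃ α : G, α⁻¹ * x * α = y) ∧ p = gs.ginf y}

/-- The summit supremum `sup_s(x)` : the minimum of `sup` over the conjugacy class of `x`. -/
noncomputable def gsups (x : G) : ℤ :=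
  sInf {p : ℤ | ∃ y : G, (∃ α : G, α⁻¹ * x * α = y) ∧ p = gs.gsup y}

/-- The preferred prefix `𝔭(x) = (xΔ^{-inf x}) ∧ (x⁻¹Δ^{sup x}) ∧ Δ`. -/
noncomputable def pp (x : G) : G :=
  gs.wedge (gs.wedge (x * gs.Δ ^ (-gs.ginf x)) (x⁻¹ * gs.Δ ^ gs.gsup x)) gs.Δ

/-- Cyclic (left) sliding `𝔰(x) = 𝔭(x)⁻¹ x 𝔭(x)`. -/
noncomputable def sl (x : G) : G := (gs.pp x)⁻¹ * x * gs.pp x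

/-- The preferred suffix `𝔭↰(x) = (Δ^{-inf x}x) ∧↰ (Δ^{sup x}x⁻¹) ∧↰ Δ`. -/
noncomputable def ps (x : G) : G :=
  gs.rwedge (gs.rwedge (gs.Δ ^ (-gs.ginf x) * x) (gs.Δ ^ gs.gsup x * x⁻¹)) gs.Δ

/-- Cyclic right sliding `𝔰↰(x) = 𝔭↰(x) x 𝔭↰(x)⁻¹`. -/
noncomputable def rsl (x : G) : G := gs.ps x * x * (gs.ps x)⁻¹

/-- The super summit set `SSS(x)` : conjugates of `x` with maximal infimum and minimal
supremum among all conjugates of `x`. -/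
def SSS (x : G) : Set G :=
  {y | (∃ α : G, α⁻¹ * x * α = y) ∧
    ∀ z : G, (∃ α : G, α⁻¹ * x * α = z) → gs.ginf z ≤ gs.ginf y ∧ gs.gsup y ≤ gs.gsup z}

/-- The set of sliding circuits `SC(x)` : conjugates `y` of `x` with `𝔰^m(y) = y` for
some `m ≥ 1`. -/
noncomputable def SC (x : G) : Set G :=
  {y | (∃ α : G, α⁻¹ * x * α = y) ∧ ∃ m : ℕ, 1 ≤ m ∧ (gs.sl)^[m] y = y}

/-- The transport `α^{(1)} = 𝔭(x)⁻¹ α 𝔭(x^α)` of `α` at `x`. -/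
noncomputable def transport (x α : G) : G := (gs.pp x)⁻¹ * α * gs.pp (α⁻¹ * x * α)

/-- Iterated transport `α^{(i)}` of `α` at `x`: `α^{(0)} = α` and `α^{(i+1)}` is the
transport of `α^{(i)}` at `𝔰^i(x)`. -/
noncomputable def transportIter (x α : G) : ℕ → G
  | 0 => α
  | i + 1 => gs.transport ((gs.sl)^[i] x) (transportIter x α i)

/-- `c` is the `⪯`-minimal element `c_s(y)` satisfying `s ⪯ c` and `y^c ∈ SC(x)`. -/
def IsMinSCConj (x y s c : G) : Prop :=
  gs.pre s c ∧ (c⁻¹ * y * c) ∈ gs.SC x ∧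
    ∀ d : G, gs.pre s d → (d⁻¹ * y * d) ∈ gs.SC x → gs.pre c d

/-- `s` is an indecomposable conjugator starting at `u`: `u^s ∈ SC(x)`, `s ≠ 1` and there
is no `t` with `1 ≺ t ≺ s` and `u^t ∈ SC(x)`. -/
def IsIndecomposableConjugator (x u s : G) : Prop :=
  (s⁻¹ * u * s) ∈ gs.SC x ∧ s ≠ 1 ∧
    ¬ ∃ t : G, (gs.pre 1 t ∧ t ≠ 1) ∧ (gs.pre t s ∧ t ≠ s) ∧ (t⁻¹ * u * t) ∈ gs.SC x

/-- `u` is the pullback of `s` at `y = 𝔰(z)` : the `⪯`-minimal positive element with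
`z^u ∈ SSS(x)` and `s ⪯ u^{(1)}` (transport at `z`). -/
def IsPullback (x z s u : G) : Prop :=
  u ∈ gs.P ∧ (u⁻¹ * z * u) ∈ gs.SSS x ∧ gs.pre s (gs.transport z u) ∧
    ∀ u' : G, u' ∈ gs.P → (u'⁻¹ * z * u') ∈ gs.SSS x → gs.pre s (gs.transport z u') →
      gs.pre u u'

/-- The pullback `s_{(1)}` of `s` at `y = 𝔰(z)`. -/
noncomputable def pullbackOne (x z s : G) : G :=
  @Classical.epsilon G ⟨1⟩ (fun u => gs.IsPullback x z s u)

/-- The `k`-fold pullback `s_{(k)}` of `s` at `y = 𝔰^k(z)` (an element at `z`):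
`s_{(0)} = s` and `s_{(k+1)}` is the pullback at `𝔰(z)` (relative to `z`) of the `k`-fold
pullback of `s` at `𝔰^k(𝔰(z)) = y`. -/
noncomputable def pullbackIter (x : G) : G → ℕ → G → G
  | _, 0, s => s
  | z, k + 1, s => gs.pullbackOne x z (pullbackIter x (gs.sl z) k s)

end GarsideStructure

open GarsideStructure

variable {G : Type*} [Group G]

namespace GarsideStructure

section Sliding

variable {gs : GarsideStructure G}

theorem conj_zpow_mem {a : G} (ha : a ∈ gs.P) (n : ℤ) : gs.Δ ^ (-n) * a * gs.Δ ^ n ∈ gs.P := by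
  induction n with
  | zero => simpa using ha
  | succ n ih =>
    have h := gs.conj_Delta_mem _ ih
    convert h using 1
    group
  | pred n ih =>
    apply gs.mem_of_conj_Delta_mem
    convert ih using 1
    group

theorem conj_zpow_mem' {a : G} (ha : a ∈ gs.P) (n : ℤ) : gs.Δ ^ n * a * gs.Δ ^ (-n) ∈ gs.P := by
  simpa using conj_zpow_mem ha (-n)

theorem pre_mul {p q : ℤ} {x y : G} (hx : gs.pre (gs.Δ ^ p) x) (hy : gs.pre (gs.Δ ^ q) y) :
    gs.pre (gs.Δ ^ (p + q)) (x * y) := by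
  have h := gs.mul_mem (conj_zpow_mem hx q) hy
  unfold pre
  convert h using 1
  group

theorem pre_inv_of_zpow_pre {p : ℤ} {x : G} (hx : gs.pre (gs.Δ ^ p) x) :
    gs.pre x⁻¹ (gs.Δ ^ (-p)) := by
  have h := conj_zpow_mem' hx p
  unfold pre
  convert h using 1
  group

theorem zpow_pre_inv_of_pre {p : ℤ} {x : G} (hx : gs.pre x (gs.Δ ^ p)) :
    gs.pre (gs.Δ ^ (-p)) x⁻¹ := by
  have h := conj_zpow_mem' hx p
  unfold pre
  convert h using 1
  group

theorem exists_zpow_pre_and_pre (gs : GarsideStructure G) (x : G) :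
    (∃ p : ℤ, gs.pre (gs.Δ ^ p) x) ∧ ∃ q : ℤ, gs.pre x (gs.Δ ^ q) := by
  have hx : x ∈ Subgroup.closure {s : G | s ∈ gs.P ∧ s⁻¹ * gs.Δ ∈ gs.P} := by
    rw [gs.simples_generate]
    trivial
  induction hx using Subgroup.closure_induction with
  | mem s hs => exact ⟨⟨0, by simpa [pre] using hs.1⟩, ⟨1, by simpa [pre] using hs.2⟩⟩
  | one => exact ⟨⟨0, by simpa [pre] using gs.one_mem⟩, ⟨0, by simpa [pre] using gs.one_mem⟩⟩
  | mul x y _ _ hx hy =>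
    obtain ⟨⟨p, hp⟩, q, hq⟩ := hx
    obtain ⟨⟨p', hp'⟩, q', hq'⟩ := hy
    refine ⟨⟨p + p', pre_mul hp hp'⟩, -(-q' + -q), ?_⟩
    simpa using pre_inv_of_zpow_pre (pre_mul (zpow_pre_inv_of_pre hq') (zpow_pre_inv_of_pre hq))
  | inv x _ hx =>
    obtain ⟨⟨p, hp⟩, q, hq⟩ := hx
    exact ⟨⟨-q, zpow_pre_inv_of_pre hq⟩, ⟨-p, pre_inv_of_zpow_pre hp⟩⟩

theorem pow_Delta_mem (gs : GarsideStructure G) (n : ℕ) : gs.Δ ^ n ∈ gs.P := by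
  induction n with
  | zero => simpa using gs.one_mem
  | succ n ih => exact pow_succ gs.Δ n ▸ gs.mul_mem ih gs.Δ_mem

theorem subsingleton_of_Delta_eq_one (h : gs.Δ = 1) : Subsingleton G := by
  have hs : {s : G | s ∈ gs.P ∧ s⁻¹ * gs.Δ ∈ gs.P} ⊆ {1} := fun s hs ↦
    gs.eq_one_of_mem_of_inv_mem s hs.1 (by simpa [h] using hs.2)
  have hbot : (⊤ : Subgroup G) = ⊥ := by
    rw [← gs.simples_generate, Subgroup.closure_eq_bot_iff]
    exact hs
  exact subsingleton_of_forall_eq 1 fun x ↦ by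
    have hx : x ∈ (⊤ : Subgroup G) := trivial
    rwa [hbot, Subgroup.mem_bot] at hx

theorem zpow_exponent_le (h : gs.Δ ≠ 1) {p q : ℤ} {x : G} (hp : gs.pre (gs.Δ ^ p) x)
    (hq : gs.pre x (gs.Δ ^ q)) : p ≤ q := by
  by_contra! hlt
  obtain ⟨n, rfl⟩ : ∃ n : ℕ, p = q + n + 1 := ⟨(p - q - 1).toNat, by lia⟩
  refine h (gs.eq_one_of_mem_of_inv_mem _ gs.Δ_mem ?_)
  convert gs.mul_mem (gs.pow_Delta_mem n) (gs.mul_mem hp hq) using 1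
  group

theorem zpow_ginf_pre (h : gs.Δ ≠ 1) (x : G) : gs.pre (gs.Δ ^ gs.ginf x) x := by
  obtain ⟨⟨p, hp⟩, q, hq⟩ := gs.exists_zpow_pre_and_pre x
  exact Int.csSup_mem (s := {p : ℤ | gs.pre (gs.Δ ^ p) x}) ⟨p, hp⟩
    ⟨q, fun _ hr ↦ zpow_exponent_le h hr hq⟩

theorem pre_zpow_gsup (h : gs.Δ ≠ 1) (x : G) : gs.pre x (gs.Δ ^ gs.gsup x) := by
  obtain ⟨⟨p, hp⟩, q, hq⟩ := gs.exists_zpow_pre_and_pre x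
  exact Int.csInf_mem (s := {p : ℤ | gs.pre x (gs.Δ ^ p)}) ⟨q, hq⟩
    ⟨p, fun _ hr ↦ zpow_exponent_le h hp hr⟩

theorem ginf_le_of_zpow_pre (h : gs.Δ ≠ 1) {p : ℤ} {x : G} (hp : gs.pre (gs.Δ ^ p) x) :
    p ≤ gs.ginf x := by
  obtain ⟨q, hq⟩ := (gs.exists_zpow_pre_and_pre x).2
  exact le_csSup (s := {p : ℤ | gs.pre (gs.Δ ^ p) x}) ⟨q, fun _ hr ↦ zpow_exponent_le h hr hq⟩ hp

theorem gsup_le_of_pre_zpow (h : gs.Δ ≠ 1) {q : ℤ} {x : G} (hq : gs.pre x (gs.Δ ^ q)) :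
    gs.gsup x ≤ q := by
  obtain ⟨p, hp⟩ := (gs.exists_zpow_pre_and_pre x).1
  exact csInf_le (s := {p : ℤ | gs.pre x (gs.Δ ^ p)}) ⟨p, fun _ hr ↦ zpow_exponent_le h hp hr⟩ hq

theorem zpow_pre_of_le {p q : ℤ} {x : G} (hpq : p ≤ q) (hq : gs.pre (gs.Δ ^ q) x) :
    gs.pre (gs.Δ ^ p) x := by
  obtain ⟨n, rfl⟩ : ∃ n : ℕ, q = p + n := ⟨(q - p).toNat, by lia⟩
  unfold pre
  convert gs.mul_mem (gs.pow_Delta_mem n) hq using 1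
  group

theorem pre_zpow_of_le {p q : ℤ} {x : G} (hpq : p ≤ q) (hp : gs.pre x (gs.Δ ^ p)) :
    gs.pre x (gs.Δ ^ q) := by
  obtain ⟨n, rfl⟩ : ∃ n : ℕ, q = p + n := ⟨(q - p).toNat, by lia⟩
  unfold pre
  convert gs.mul_mem hp (gs.pow_Delta_mem n) using 1
  group

theorem pp_pre_mul_zpow (x : G) : gs.pre (gs.pp x) (x * gs.Δ ^ (-gs.ginf x)) := by
  have h := gs.mul_mem (gs.wedge_le_left
    (gs.wedge (x * gs.Δ ^ (-gs.ginf x)) (x⁻¹ * gs.Δ ^ gs.gsup x)) gs.Δ)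
    (gs.wedge_le_left (x * gs.Δ ^ (-gs.ginf x)) (x⁻¹ * gs.Δ ^ gs.gsup x))
  rwa [mul_assoc, mul_inv_cancel_left] at h

theorem pp_pre_inv_mul_zpow (x : G) : gs.pre (gs.pp x) (x⁻¹ * gs.Δ ^ gs.gsup x) := by
  have h := gs.mul_mem (gs.wedge_le_left
    (gs.wedge (x * gs.Δ ^ (-gs.ginf x)) (x⁻¹ * gs.Δ ^ gs.gsup x)) gs.Δ)
    (gs.wedge_le_right (x * gs.Δ ^ (-gs.ginf x)) (x⁻¹ * gs.Δ ^ gs.gsup x))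
  rwa [mul_assoc, mul_inv_cancel_left] at h

theorem pp_mem (h : gs.Δ ≠ 1) (x : G) : gs.pp x ∈ gs.P := by
  have hinf : (1 : G)⁻¹ * (x * gs.Δ ^ (-gs.ginf x)) ∈ gs.P := by
    convert conj_zpow_mem' (zpow_ginf_pre h x) (gs.ginf x) using 1
    group
  have hsup : (1 : G)⁻¹ * (x⁻¹ * gs.Δ ^ gs.gsup x) ∈ gs.P := by
    simpa [pre] using pre_zpow_gsup h x
  have hmem := gs.le_wedge _ _ 1 (gs.le_wedge _ _ 1 hinf hsup) (by simpa using gs.Δ_mem)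
  rwa [inv_one, one_mul] at hmem

theorem ginf_le_ginf_sl (h : gs.Δ ≠ 1) (x : G) : gs.ginf x ≤ gs.ginf (gs.sl x) := by
  apply ginf_le_of_zpow_pre h
  have hmem := conj_zpow_mem (gs.mul_mem (pp_pre_mul_zpow (gs := gs) x)
    (conj_zpow_mem' (pp_mem h x) (gs.ginf x))) (gs.ginf x)
  unfold pre sl
  convert hmem using 1
  group

theorem gsup_sl_le_gsup (h : gs.Δ ≠ 1) (x : G) : gs.gsup (gs.sl x) ≤ gs.gsup x := by
  apply gsup_le_of_pre_zpow h
  have hmem := gs.mul_mem (pp_pre_inv_mul_zpow (gs := gs) x)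
    (conj_zpow_mem (pp_mem h x) (gs.gsup x))
  unfold pre sl
  convert hmem using 1
  group

theorem finite_pre_pow (gs : GarsideStructure G) (n : ℕ) :
    {z : G | z ∈ gs.P ∧ gs.pre z (gs.Δ ^ n)}.Finite := by
  induction n with
  | zero =>
    refine (Set.finite_singleton (1 : G)).subset fun z hz ↦ ?_
    exact gs.eq_one_of_mem_of_inv_mem z hz.1 (by simpa [pre] using hz.2)
  | succ n ih =>
    refine (ih.image2 (· * ·) gs.simples_finite).subset fun z ⟨hz, hzn⟩ ↦ ?_
    have hwedge : (z * gs.Δ⁻¹)⁻¹ * gs.wedge z (gs.Δ ^ n) ∈ gs.P := by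
      refine gs.le_wedge _ _ _ (by simpa using gs.Δ_mem) (gs.mem_of_conj_Delta_mem _ ?_)
      unfold pre at hzn
      convert hzn using 1
      group
    refine ⟨gs.wedge z (gs.Δ ^ n), ⟨?_, gs.wedge_le_right _ _⟩,
      (gs.wedge z (gs.Δ ^ n))⁻¹ * z, ⟨gs.wedge_le_left _ _, ?_⟩, by simp⟩
    · simpa using gs.le_wedge z (gs.Δ ^ n) 1 (by simpa using hz)
        (by simpa using gs.pow_Delta_mem n)
    · convert gs.conj_Delta_mem _ hwedge using 1
      group

theorem finite_zpow_interval (gs : GarsideStructure G) (p q : ℤ) :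
    {y : G | gs.pre (gs.Δ ^ p) y ∧ gs.pre y (gs.Δ ^ q)}.Finite := by
  refine ((gs.finite_pre_pow (q - p).toNat).image (gs.Δ ^ p * ·)).subset fun y ⟨hp, hq⟩ ↦ ?_
  refine ⟨(gs.Δ ^ p)⁻¹ * y, ⟨hp, ?_⟩, by simp⟩
  have h := pre_zpow_of_le (show q ≤ p + (q - p).toNat by lia) hq
  unfold pre at h ⊢
  convert h using 1
  rw [zpow_add, zpow_natCast]
  group

theorem finite_range_iterate_sl (gs : GarsideStructure G) (x : G) :
    (Set.range fun k : ℕ ↦ (gs.sl)^[k] x).Finite := by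
  by_cases h : gs.Δ = 1
  · have := subsingleton_of_Delta_eq_one h
    exact Set.toFinite _
  refine (gs.finite_zpow_interval (gs.ginf x) (gs.gsup x)).subset ?_
  rintro _ ⟨k, rfl⟩
  have hk : gs.ginf x ≤ gs.ginf ((gs.sl)^[k] x) ∧ gs.gsup ((gs.sl)^[k] x) ≤ gs.gsup x := by
    induction k with
    | zero => simp
    | succ k ih =>
      rw [Function.iterate_succ_apply']
      exact ⟨ih.1.trans (ginf_le_ginf_sl h _), (gsup_sl_le_gsup h _).trans ih.2⟩
  exact ⟨zpow_pre_of_le hk.1 (zpow_ginf_pre h _), pre_zpow_of_le hk.2 (pre_zpow_gsup h _)⟩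

theorem exists_conj_eq_iterate_sl (gs : GarsideStructure G) (x : G) (k : ℕ) :
    ∃ α : G, α⁻¹ * x * α = (gs.sl)^[k] x := by
  induction k with
  | zero => exact ⟨1, by simp⟩
  | succ k ih =>
    obtain ⟨α, hα⟩ := ih
    refine ⟨α * gs.pp ((gs.sl)^[k] x), ?_⟩
    rw [Function.iterate_succ_apply']
    change _ = (gs.pp ((gs.sl)^[k] x))⁻¹ * (gs.sl)^[k] x * gs.pp ((gs.sl)^[k] x)
    rw [mul_inv_rev]
    nth_rewrite 4 [← hα]
    group

end Sliding

end GarsideStructure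

/-- Iterated cyclic sliding eventually reaches a period; in particular `𝔰^k(x) ∈ SC(x)`
and `𝔰^{j-i}(𝔰^k(x)) = 𝔰^k(x)` for all `k ≥ i`. -/
theorem cyclic_sliding_reaches_period (gs : GarsideStructure G) (x : G) :
    ∃ i j : ℕ, i < j ∧ (gs.sl)^[i] x = (gs.sl)^[j] x ∧
      ∀ k : ℕ, i ≤ k →
        (gs.sl)^[k] x ∈ gs.SC x ∧ (gs.sl)^[j - i] ((gs.sl)^[k] x) = (gs.sl)^[k] x := by
  have hinj : ¬ Function.Injective fun k : ℕ ↦ (gs.sl)^[k] x := fun hinj ↦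
    Set.infinite_range_of_injective hinj (gs.finite_range_iterate_sl x)
  obtain ⟨i, j, heq, hlt⟩ : ∃ i j : ℕ, (gs.sl)^[i] x = (gs.sl)^[j] x ∧ i < j := by
    simp only [Function.Injective, not_forall] at hinj
    obtain ⟨i, j, heq, hne⟩ := hinj
    rcases lt_or_gt_of_ne hne with hlt | hlt
    exacts [⟨i, j, heq, hlt⟩, ⟨j, i, heq.symm, hlt⟩]
  have hper : ∀ k : ℕ, i ≤ k → (gs.sl)^[j - i] ((gs.sl)^[k] x) = (gs.sl)^[k] x := fun k hk ↦ by
    rw [← Function.iterate_add_apply, show j - i + k = (k - i) + j by lia,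
      Function.iterate_add_apply, ← heq, ← Function.iterate_add_apply, Nat.sub_add_cancel hk]
  exact ⟨i, j, hlt, heq, fun k hk ↦
    ⟨⟨gs.exists_conj_eq_iterate_sl x k, j - i, by lia, hper k hk⟩, hper k hk⟩⟩
end

section
/- Let G be a Garside group of finite type, x ∈ G and α, β ∈ G such that x, x^α, x^β and x^{α∧β} all lie in SSS(x), and consider transports at x. Then: (1) if α is positive then α^{(1)} is positive; (2) if α is positive then 𝔭(x) ⪯ α 𝔭(x^α); (3) if α = Δ^k for some integer k then α^{(1)} = Δ^k; (4) if α ⪯ β then α^{(1)} ⪯ β^{(1)}; (5) if α is simple then α^{(1)} is simple; (6) (α ∧ β)^{(1)} = α^{(1)} ∧ β^{(1)}. -/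
namespace GarsideStructure

variable {G : Type*} [Group G] (gs : GarsideStructure G)

lemma pre_refl (a : G) : gs.pre a a := by
  simpa [pre] using gs.one_mem

lemma pre_trans {a b c : G} (hab : gs.pre a b) (hbc : gs.pre b c) : gs.pre a c := by
  simpa [pre, mul_assoc] using gs.mul_mem hab hbc

lemma pre_antisymm {a b : G} (hab : gs.pre a b) (hba : gs.pre b a) : a = b :=
  inv_mul_eq_one.1 (gs.eq_one_of_mem_of_inv_mem _ hab (by simpa [pre] using hba))

lemma pre_mul_left_iff (g a b : G) : gs.pre (g * a) (g * b) ↔ gs.pre a b := by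
  simp [pre, mul_assoc]

lemma pre_wedge_iff (a b c : G) : gs.pre c (gs.wedge a b) ↔ gs.pre c a ∧ gs.pre c b :=
  ⟨fun h => ⟨gs.pre_trans h (gs.wedge_le_left a b), gs.pre_trans h (gs.wedge_le_right a b)⟩,
    fun h => gs.le_wedge a b c h.1 h.2⟩

lemma eq_of_forall_pre_iff {a b : G} (h : ∀ c, gs.pre c a ↔ gs.pre c b) : a = b :=
  gs.pre_antisymm ((h a).1 (gs.pre_refl a)) ((h b).2 (gs.pre_refl b))

/-- Conjugation by a power of `Δ` preserves positivity. -/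
lemma conj_Delta_zpow_mem_iff (k : ℤ) (a : G) :
    gs.Δ ^ (-k) * a * gs.Δ ^ k ∈ gs.P ↔ a ∈ gs.P := by
  have step : ∀ b : G, gs.Δ⁻¹ * b * gs.Δ ∈ gs.P ↔ b ∈ gs.P :=
    fun b => ⟨gs.mem_of_conj_Delta_mem b, gs.conj_Delta_mem b⟩
  induction k using Int.induction_on with
  | zero => simp
  | succ n ih =>
    refine Iff.trans ?_ ih
    rw [← step (gs.Δ ^ (-(n : ℤ)) * a * gs.Δ ^ (n : ℤ))]
    simp only [zpow_neg, zpow_add_one, mul_inv_rev, mul_assoc]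
  | pred n ih =>
    refine Iff.trans ?_ ih
    rw [← step (gs.Δ ^ (-(-(n : ℤ) - 1)) * a * gs.Δ ^ (-(n : ℤ) - 1))]
    have hinv : gs.Δ⁻¹ * gs.Δ ^ (-(-(n : ℤ) - 1)) = gs.Δ ^ (-(-(n : ℤ))) := by group
    have hmul : gs.Δ ^ (-(n : ℤ) - 1) * gs.Δ = gs.Δ ^ (-(n : ℤ)) := by group
    rw [← hmul, ← hinv]
    simp only [mul_assoc]

lemma pre_mul_Delta_zpow_iff (k : ℤ) (a b : G) :
    gs.pre (a * gs.Δ ^ k) (b * gs.Δ ^ k) ↔ gs.pre a b := by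
  rw [pre, pre, ← gs.conj_Delta_zpow_mem_iff k (a⁻¹ * b)]
  simp only [zpow_neg, mul_inv_rev, mul_assoc]

/-- Translating by `g` on the left and by a power of `Δ` on the right has an inverse
of the same form, hence is residuated. -/
lemma pre_mul_mul_Delta_zpow_iff (g c a : G) (k : ℤ) :
    gs.pre c (g * a * gs.Δ ^ k) ↔ gs.pre (g⁻¹ * c * gs.Δ ^ (-k)) a := by
  rw [← gs.pre_mul_Delta_zpow_iff k _ a, ← gs.pre_mul_left_iff g (_ * _)]
  simp [mul_assoc]

lemma mul_wedge (g a b : G) : g * gs.wedge a b = gs.wedge (g * a) (g * b) :=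
  gs.eq_of_forall_pre_iff fun c => by
    have h : ∀ d, gs.pre c (g * d) ↔ gs.pre (g⁻¹ * c) d := fun d => by
      simpa using gs.pre_mul_mul_Delta_zpow_iff g c d 0
    simp only [pre_wedge_iff, h]

/-- The meet `xaΔ^m ∧ x⁻¹aΔ^n ∧ aΔ`, which for `m = -inf(x)`, `n = sup(x)` equals
`a 𝔭(x^a)` whenever `x` and `x^a` have the same infimum and supremum. -/
def translatedPrefix (x : G) (m n : ℤ) (a : G) : G :=
  gs.wedge (gs.wedge (x * a * gs.Δ ^ m) (x⁻¹ * a * gs.Δ ^ n)) (a * gs.Δ)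

lemma pre_translatedPrefix_iff (x : G) (m n : ℤ) (a c : G) :
    gs.pre c (gs.translatedPrefix x m n a) ↔
      (gs.pre (x⁻¹ * c * gs.Δ ^ (-m)) a ∧ gs.pre (x * c * gs.Δ ^ (-n)) a) ∧
        gs.pre (c * gs.Δ ^ (-1 : ℤ)) a := by
  have hΔ : gs.pre c (a * gs.Δ) ↔ gs.pre (c * gs.Δ ^ (-1 : ℤ)) a := by
    simpa using gs.pre_mul_mul_Delta_zpow_iff 1 c a 1
  rw [translatedPrefix, pre_wedge_iff, pre_wedge_iff, pre_mul_mul_Delta_zpow_iff,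
    pre_mul_mul_Delta_zpow_iff, hΔ, inv_inv]

lemma translatedPrefix_wedge (x : G) (m n : ℤ) (a b : G) :
    gs.translatedPrefix x m n (gs.wedge a b) =
      gs.wedge (gs.translatedPrefix x m n a) (gs.translatedPrefix x m n b) :=
  gs.eq_of_forall_pre_iff fun c => by
    simp only [pre_wedge_iff, pre_translatedPrefix_iff]
    tauto

lemma translatedPrefix_mono (x : G) (m n : ℤ) {a b : G} (h : gs.pre a b) :
    gs.pre (gs.translatedPrefix x m n a) (gs.translatedPrefix x m n b) := by
  obtain ⟨⟨h₁, h₂⟩, h₃⟩ := (gs.pre_translatedPrefix_iff x m n a _).1 (gs.pre_refl _)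
  exact (gs.pre_translatedPrefix_iff x m n b _).2
    ⟨⟨gs.pre_trans h₁ h, gs.pre_trans h₂ h⟩, gs.pre_trans h₃ h⟩

lemma translatedPrefix_Delta_zpow (x : G) (m n k : ℤ) :
    gs.translatedPrefix x m n (gs.Δ ^ k) = gs.translatedPrefix x m n 1 * gs.Δ ^ k :=
  gs.eq_of_forall_pre_iff fun c => by
    have h := gs.pre_mul_mul_Delta_zpow_iff 1 c (gs.translatedPrefix x m n 1) k
    have h' : ∀ d : G, gs.pre d (gs.Δ ^ k) ↔ gs.pre (d * gs.Δ ^ (-k)) 1 := fun d => by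
      simpa using gs.pre_mul_mul_Delta_zpow_iff 1 d 1 k
    rw [one_mul] at h
    rw [h]
    simp only [pre_translatedPrefix_iff, h', inv_one, one_mul, mul_assoc, ← zpow_add,
      add_comm (-k)]

lemma pp_eq_translatedPrefix_one (x : G) :
    gs.pp x = gs.translatedPrefix x (-gs.ginf x) (gs.gsup x) 1 := by
  simp [pp, translatedPrefix]

lemma ginf_eq_and_gsup_eq_of_mem_SSS {x y z : G} (hy : y ∈ gs.SSS x) (hz : z ∈ gs.SSS x) :
    gs.ginf y = gs.ginf z ∧ gs.gsup y = gs.gsup z :=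
  ⟨le_antisymm (hz.2 y hy.1).1 (hy.2 z hz.1).1, le_antisymm (hy.2 z hz.1).2 (hz.2 y hy.1).2⟩

lemma mul_pp_conj {x a : G} (hx : x ∈ gs.SSS x) (ha : a⁻¹ * x * a ∈ gs.SSS x) :
    a * gs.pp (a⁻¹ * x * a) = gs.translatedPrefix x (-gs.ginf x) (gs.gsup x) a := by
  obtain ⟨hinf, hsup⟩ := gs.ginf_eq_and_gsup_eq_of_mem_SSS ha hx
  rw [pp, hinf, hsup]
  simp [translatedPrefix, mul_wedge, mul_assoc]

lemma transport_eq {x a : G} (hx : x ∈ gs.SSS x) (ha : a⁻¹ * x * a ∈ gs.SSS x) :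
    gs.transport x a =
      (gs.pp x)⁻¹ * gs.translatedPrefix x (-gs.ginf x) (gs.gsup x) a := by
  rw [transport, mul_assoc, gs.mul_pp_conj hx ha]

end GarsideStructure

open GarsideStructure

variable {G : Type*} [Group G]

/-- Properties of the transport map at super summit elements. -/
theorem transport_properties (gs : GarsideStructure G) (x α β : G)
    (hx : x ∈ gs.SSS x) (hα : α⁻¹ * x * α ∈ gs.SSS x) (hβ : β⁻¹ * x * β ∈ gs.SSS x)
    (hαβ : (gs.wedge α β)⁻¹ * x * gs.wedge α β ∈ gs.SSS x) :
    (α ∈ gs.P → gs.transport x α ∈ gs.P) ∧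
    (α ∈ gs.P → gs.pre (gs.pp x) (α * gs.pp (α⁻¹ * x * α))) ∧
    (∀ k : ℤ, α = gs.Δ ^ k → gs.transport x α = gs.Δ ^ k) ∧
    (gs.pre α β → gs.pre (gs.transport x α) (gs.transport x β)) ∧
    (gs.simple α → gs.simple (gs.transport x α)) ∧
    gs.transport x (gs.wedge α β) = gs.wedge (gs.transport x α) (gs.transport x β) := by
  have pre_prefix : α ∈ gs.P → gs.pre (gs.pp x) (α * gs.pp (α⁻¹ * x * α)) := fun h => by
    rw [gs.mul_pp_conj hx hα, gs.pp_eq_translatedPrefix_one]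
    exact gs.translatedPrefix_mono _ _ _ (by simpa [pre] using h)
  have pos : α ∈ gs.P → gs.transport x α ∈ gs.P := fun h => by
    simpa [pre, transport, mul_assoc] using pre_prefix h
  refine ⟨pos, pre_prefix, ?_, ?_, ?_, ?_⟩
  · intro k hk
    rw [gs.transport_eq hx hα, hk, gs.translatedPrefix_Delta_zpow,
      ← gs.pp_eq_translatedPrefix_one, inv_mul_cancel_left]
  · intro h
    rw [gs.transport_eq hx hα, gs.transport_eq hx hβ, gs.pre_mul_left_iff]
    exact gs.translatedPrefix_mono _ _ _ h
  · intro h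
    refine ⟨pos h.1, ?_⟩
    have hle := gs.translatedPrefix_mono x (-gs.ginf x) (gs.gsup x) h.2
    have hΔ := gs.translatedPrefix_Delta_zpow x (-gs.ginf x) (gs.gsup x) 1
    rw [zpow_one, ← gs.pp_eq_translatedPrefix_one] at hΔ
    rw [hΔ] at hle
    rw [gs.transport_eq hx hα]
    simpa [pre, mul_assoc] using hle
  · rw [gs.transport_eq hx hα, gs.transport_eq hx hβ, gs.transport_eq hx hαβ,
      gs.translatedPrefix_wedge, gs.mul_wedge]
end
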